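/- arXiv:1809.02725 — 8 statements merged into one kernel-verified Lean document; each statement's English description precedes it below -/
import Mathlib

section
/- For every α > log 3/log 2 − 1 and every ε > 0 there exists c₀ > 1 such that for every c with 1 < c < c₀ there exists a continuous 2π-periodic function φ : ℝ → ℝ that is even, nonconstant, satisfies sup_{x∈ℝ} |φ(x)| < ε, and solves the stationary equation (c + D_α)φ + φ² = 0, i.e. for every n ∈ ℤ one has (c − |n|^α)·φ̂(n) + (φ²)̂(n) = 0. -/
open MeasureTheory

/-- The `n`-th Fourier coefficient of a (2π-periodic) function `f : ℝ → ℝ`: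
`f̂(n) = (1/(2π)) ∫_{-π}^{π} f(x) e^{-inx} dx`. -/
noncomputable def fourierCoeff2pi (f : ℝ → ℝ) (n : ℤ) : ℂ :=
  (1 / (2 * Real.pi) : ℂ) *
    ∫ x in (-Real.pi)..Real.pi, (f x : ℂ) * Complex.exp (-(Complex.I * (n : ℂ) * (x : ℂ)))

open Filter Topology

section Bifurcation

/-- A surjective partial derivative makes an equation solvable near a known solution. -/
theorem HasStrictFDerivAt.eventually_exists_mem_eq_zero {P E G : Type*}
    [NormedAddCommGroup P] [NormedSpace ℝ P] [CompleteSpace P]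
    [NormedAddCommGroup E] [NormedSpace ℝ E] [CompleteSpace E]
    [NormedAddCommGroup G] [NormedSpace ℝ G] [CompleteSpace G]
    {f : P × E → G} {f' : P × E →L[ℝ] G} {p₀ : P} {x₀ : E}
    (hf : HasStrictFDerivAt f f' (p₀, x₀)) (hsurj : ∀ y, ∃ x, f' (0, x) = y)
    (h₀ : f (p₀, x₀) = 0) {U : Set (P × E)} (hU : U ∈ 𝓝 (p₀, x₀)) :
    ∀ᶠ p in 𝓝 p₀, ∃ x, (p, x) ∈ U ∧ f (p, x) = 0 := by
  have hF : HasStrictFDerivAt (fun q : P × E => (q.1, f q))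
      ((ContinuousLinearMap.fst ℝ P E).prod f') (p₀, x₀) :=
    hasStrictFDerivAt_fst.prodMk hf
  have hmap := hF.map_nhds_eq_of_surj (by
    rw [LinearMap.range_eq_top]
    rintro ⟨p, y⟩
    obtain ⟨x, hx⟩ := hsurj (y - f' (p, 0))
    refine ⟨(p, x), ?_⟩
    have : f' (p, x) = f' (p, 0) + f' (0, x) := by rw [← map_add]; simp
    simp [this, hx])
  have himg := image_mem_map (m := fun q : P × E => (q.1, f q)) hU
  rw [hmap, h₀] at himg
  have hcont : Tendsto (fun p : P => (p, (0 : G))) (𝓝 p₀) (𝓝 (p₀, 0)) :=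
    (Continuous.prodMk_left (0 : G)).tendsto p₀
  filter_upwards [hcont himg] with p hp
  obtain ⟨⟨q, x⟩, hq, hqx⟩ := hp
  obtain ⟨rfl, hx⟩ := Prod.mk.inj hqx
  exact ⟨x, hq, hx⟩

/-- Lyapunov–Schmidt reduction at a simple eigenvalue for a quadratic equation in a Banach
algebra, in the scaling where the bifurcation parameter is `δ ^ 2`. -/
theorem eventually_exists_quadratic_bifurcation {A : Type*} [NormedCommRing A] [NormedAlgebra ℝ A]
    [CompleteSpace A] (M : A →L[ℝ] A) (ℓ : A →L[ℝ] ℝ) (e : A) (hμ : 0 < ℓ (e * M (e * e)))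
    {ε : ℝ} (hε : 0 < ε) :
    ∀ᶠ δ in 𝓝 (0 : ℝ), ∃ (b : ℝ) (w : A), b ≠ 0 ∧ ‖δ • (b • e + δ • w)‖ < ε ∧
      b + ℓ ((2 * b) • (e * w) + δ • (w * w)) = 0 ∧
      w + M (δ ^ 2 • w + (b • e + δ • w) * (b • e + δ • w)) = 0 := by
  set μ := ℓ (e * M (e * e)) with hμdef
  set h := M (e * e) with hh
  set b₀ : ℝ := √(1 / (2 * μ)) with hb₀
  have hb₀pos : 0 < b₀ := by positivity
  have hb₀sq : 2 * b₀ ^ 2 * μ = 1 := by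
    rw [hb₀, Real.sq_sqrt (by positivity)]; field_simp
  set w₀ : A := -(b₀ ^ 2) • h with hw₀
  let f : ℝ × ℝ × A → ℝ × A := fun p =>
    (p.2.1 + ℓ ((2 * p.2.1) • (e * p.2.2) + p.1 • (p.2.2 * p.2.2)),
      p.2.2 + M (p.1 ^ 2 • p.2.2 + (p.2.1 • e + p.1 • p.2.2) * (p.2.1 • e + p.1 • p.2.2)))
  have hf : ContDiff ℝ 1 f := by fun_prop
  have hstrict := hf.contDiffAt.hasStrictFDerivAt (x := ((0 : ℝ), b₀, w₀)) one_ne_zero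
  have hℓw₀ : ℓ (e * w₀) = -(b₀ ^ 2) * μ := by simp [hw₀, hμdef]
  have hderiv : ∀ (β : ℝ) (v : A), fderiv ℝ f (0, b₀, w₀) (0, β, v) =
      (2 * b₀ * ℓ (e * v), v + (2 * b₀ * β) • h) := by
    intro β v
    have hline : HasDerivAt (fun t : ℝ => ((0 : ℝ), b₀ + t * β, w₀ + t • v)) (0, β, v) 0 := by
      refine (hasDerivAt_const _ _).prodMk (HasDerivAt.prodMk ?_ ?_)
      · simpa using ((hasDerivAt_id (0 : ℝ)).mul_const β).const_add b₀
      · simpa using ((hasDerivAt_id (0 : ℝ)).smul_const v).const_add w₀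
    have hcomp := HasFDerivAt.comp_hasDerivAt (0 : ℝ)
      (f := fun t : ℝ => ((0 : ℝ), b₀ + t * β, w₀ + t • v))
      (l := f) (l' := fderiv ℝ f (0, b₀, w₀)) (by simpa using hstrict.hasFDerivAt) hline
    have hexpand : (f ∘ fun t : ℝ => ((0 : ℝ), b₀ + t * β, w₀ + t • v)) = fun t : ℝ =>
        ((b₀ + t * β) * (1 + 2 * ℓ (e * w₀) + t * (2 * ℓ (e * v))),
          (w₀ + t • v) + ((b₀ + t * β) * (b₀ + t * β)) • h) := by
      funext t
      simp only [f, Function.comp, zero_smul, add_zero, mul_add, map_add, map_smul, smul_eq_mul,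
        mul_smul_comm, smul_mul_assoc, smul_smul, zero_pow two_ne_zero, zero_add, ← hh]
      congr 1
      ring
    rw [hexpand] at hcomp
    have hid := hasDerivAt_id (0 : ℝ)
    have hb := (hid.mul_const β).const_add b₀
    have h1 := hb.mul ((hid.mul_const (2 * ℓ (e * v))).const_add (1 + 2 * ℓ (e * w₀)))
    have h2 := ((hid.smul_const v).const_add w₀).add ((hb.mul hb).smul_const h)
    rw [hcomp.unique (h1.prodMk h2)]
    simp only [id, hℓw₀]
    congr 1
    · simp; linear_combination (-β) * hb₀sq
    · simp only [one_smul, one_mul, zero_mul, add_zero]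
      congr 2; ring
  have hzero : f (0, b₀, w₀) = 0 := by
    simp only [f, zero_smul, add_zero, map_smul, smul_eq_mul, hℓw₀, zero_pow two_ne_zero, zero_add,
      mul_smul_comm, smul_mul_assoc, smul_smul, ← hh]
    refine Prod.ext ?_ ?_
    · simp; linear_combination (-b₀) * hb₀sq
    · simp [hw₀, pow_two]
  have hU : {p : ℝ × ℝ × A | 0 < p.2.1 ∧ ‖p.1 • (p.2.1 • e + p.1 • p.2.2)‖ < ε} ∈
      𝓝 ((0 : ℝ), b₀, w₀) := by
    have hpos : IsOpen {p : ℝ × ℝ × A | 0 < p.2.1} := isOpen_lt (by fun_prop) (by fun_prop)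
    have hsmall : IsOpen {p : ℝ × ℝ × A | ‖p.1 • (p.2.1 • e + p.1 • p.2.2)‖ < ε} :=
      isOpen_lt (by fun_prop) (by fun_prop)
    exact (hpos.inter hsmall).mem_nhds (by simpa using ⟨hb₀pos, hε⟩)
  have hsurj : ∀ y : ℝ × A, ∃ x, fderiv ℝ f (0, b₀, w₀) (0, x) = y := by
    rintro ⟨r, g⟩
    have hne : 4 * b₀ ^ 2 * μ ≠ 0 := by positivity
    set β : ℝ := (2 * b₀ * ℓ (e * g) - r) / (4 * b₀ ^ 2 * μ) with hβ
    have hβ' : β * (4 * b₀ ^ 2 * μ) = 2 * b₀ * ℓ (e * g) - r := div_mul_cancel₀ _ hne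
    refine ⟨(β, g - (2 * b₀ * β) • h), ?_⟩
    rw [hderiv]
    simp only [mul_sub, map_sub, mul_smul_comm, map_smul, smul_eq_mul, ← hμdef, sub_add_cancel]
    congr 1
    linear_combination -hβ'
  filter_upwards [hstrict.eventually_exists_mem_eq_zero hsurj hzero hU] with δ
  rintro ⟨⟨b, w⟩, ⟨hb, hn⟩, hfx⟩
  exact ⟨b, w, hb.ne', hn, congrArg Prod.fst hfx, congrArg Prod.snd hfx⟩

end Bifurcation

section Cosine

open AddCircle

variable {T : ℝ}

/-- The function `cos (2 π n x / T)` on the circle of length `T`. -/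
noncomputable def circleCos (n : ℤ) : C(AddCircle T, ℝ) :=
  ⟨fun x => (fourier n x).re, Complex.continuous_re.comp (fourier n).continuous⟩

theorem circleCos_apply (n : ℤ) (x : AddCircle T) : circleCos n x = (fourier n x).re := rfl

theorem circleCos_neg (n : ℤ) : circleCos (T := T) (-n) = circleCos n := by
  ext x
  rw [circleCos_apply, fourier_neg, Complex.conj_re, circleCos_apply]

theorem circleCos_apply_neg (n : ℤ) (x : AddCircle T) : circleCos n (-x) = circleCos n x := by
  have h : circleCos n (-x) = circleCos (-n) x := by
    simp only [circleCos_apply, fourier_apply, neg_smul, smul_neg]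
  rw [h, circleCos_neg]

theorem circleCos_mul_circleCos (m n : ℤ) : circleCos (T := T) m * circleCos n =
    (1 / 2 : ℝ) • (circleCos (m + n) + circleCos (m - n)) := by
  ext x
  simp only [ContinuousMap.mul_apply, ContinuousMap.smul_apply, ContinuousMap.add_apply,
    circleCos_apply, sub_eq_add_neg m n, fourier_add, fourier_neg, Complex.mul_re,
    Complex.conj_re, Complex.conj_im, smul_eq_mul]
  ring

variable [hT : Fact (0 < T)]

theorem norm_circleCos_le (n : ℤ) : ‖circleCos (T := T) n‖ ≤ 1 := by
  refine (ContinuousMap.norm_le _ zero_le_one).2 fun x => ?_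
  calc ‖circleCos n x‖ ≤ ‖fourier n x‖ := Complex.abs_re_le_norm _
    _ ≤ ‖fourier n‖ := ContinuousMap.norm_coe_le_norm _ x
    _ = 1 := fourier_norm n

theorem integral_circleCos (n : ℤ) :
    ∫ t, circleCos (T := T) n t ∂haarAddCircle = if n = 0 then 1 else 0 := by
  split_ifs with hn
  · simp [hn, circleCos_apply]
  · have h : ∀ t : AddCircle T, circleCos n (t + ((T / 2 / n : ℝ) : AddCircle T)) = -circleCos n t := fun t => by
      rw [circleCos_apply, fourier_add_half_inv_index hn hT.out, Complex.neg_re, circleCos_apply]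
    have := integral_add_right_eq_self (μ := haarAddCircle) (circleCos (T := T) n)
      ((T / 2 / n : ℝ) : AddCircle T)
    simp only [h, integral_neg] at this
    linarith

theorem ContinuousMap.integrable_haarAddCircle (f : C(AddCircle T, ℝ)) :
    Integrable f haarAddCircle :=
  f.continuous.integrable_of_hasCompactSupport (HasCompactSupport.of_compactSpace f)

/-- The mean value of `f t * cos (2 π n t / T)`, as a continuous linear functional of `f`. -/
noncomputable def circleCosCoeff (n : ℤ) : C(AddCircle T, ℝ) →L[ℝ] ℝ :=
  LinearMap.mkContinuous
    { toFun := fun f => ∫ t, (circleCos n * f : C(AddCircle T, ℝ)) t ∂haarAddCircle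
      map_add' := fun f g => by
        simp only [mul_add, ContinuousMap.add_apply]
        exact integral_add (ContinuousMap.integrable_haarAddCircle _)
          (ContinuousMap.integrable_haarAddCircle _)
      map_smul' := fun r f => by
        simp only [mul_smul_comm, ContinuousMap.smul_apply, integral_smul, RingHom.id_apply] }
    1 fun f => by
      refine (norm_integral_le_of_norm_le_const (C := ‖circleCos (T := T) n * f‖)
        (ae_of_all _ fun x => ContinuousMap.norm_coe_le_norm _ x)).trans ?_
      simpa using (norm_mul_le _ _).trans
        (mul_le_mul_of_nonneg_right (norm_circleCos_le n) (norm_nonneg f))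

theorem circleCosCoeff_apply (n : ℤ) (f : C(AddCircle T, ℝ)) :
    circleCosCoeff n f = ∫ t, (circleCos n * f : C(AddCircle T, ℝ)) t ∂haarAddCircle := rfl

theorem circleCosCoeff_circleCos (n k : ℤ) : circleCosCoeff (T := T) n (circleCos k) =
    ((if n + k = 0 then 1 else 0) + (if n - k = 0 then 1 else 0)) / 2 := by
  simp only [circleCosCoeff_apply, circleCos_mul_circleCos, ContinuousMap.smul_apply,
    integral_smul, ContinuousMap.add_apply]
  rw [integral_add (ContinuousMap.integrable_haarAddCircle _)
    (ContinuousMap.integrable_haarAddCircle _), integral_circleCos, integral_circleCos,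
    smul_eq_mul]
  ring

theorem circleCosCoeff_neg (n : ℤ) : circleCosCoeff (T := T) (-n) = circleCosCoeff n := by
  ext f
  simp only [circleCosCoeff_apply, circleCos_neg]

theorem circleCosCoeff_circleCos_mul (n k : ℤ) (f : C(AddCircle T, ℝ)) :
    circleCosCoeff n (circleCos k * f) =
      (circleCosCoeff (n + k) f + circleCosCoeff (n - k) f) / 2 := by
  simp only [circleCosCoeff_apply, ← mul_assoc, circleCos_mul_circleCos, smul_mul_assoc, add_mul,
    ContinuousMap.smul_apply, integral_smul, ContinuousMap.add_apply]
  rw [integral_add (ContinuousMap.integrable_haarAddCircle _)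
    (ContinuousMap.integrable_haarAddCircle _), smul_eq_mul]
  ring

theorem re_fourierCoeff (n : ℤ) (f : C(AddCircle T, ℝ)) :
    (fourierCoeff (fun t => (f t : ℂ)) n).re = circleCosCoeff n f := by
  have hint : Integrable (fun t : AddCircle T => fourier (-n) t • (f t : ℂ)) haarAddCircle :=
    ((ContinuousMap.integrable_haarAddCircle f).ofReal).fourier_smul _
  rw [fourierCoeff, ← RCLike.re_eq_complex_re, ← integral_re hint, circleCosCoeff_apply]
  refine integral_congr_ae (ae_of_all _ fun t => ?_)
  simp only [smul_eq_mul, RCLike.re_eq_complex_re, Complex.re_mul_ofReal, ContinuousMap.mul_apply]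
  rw [← circleCos_apply, circleCos_neg]

/-- Bessel's inequality for the cosine coefficients of a continuous function. -/
theorem sum_sq_circleCosCoeff_le (f : C(AddCircle T, ℝ)) (s : Finset ℤ) :
    ∑ n ∈ s, circleCosCoeff n f ^ 2 ≤ ‖f‖ ^ 2 := by
  let g : C(AddCircle T, ℂ) := ⟨fun t => (f t : ℂ), Complex.continuous_ofReal.comp f.continuous⟩
  have hg : ‖g‖ ≤ ‖f‖ := (ContinuousMap.norm_le _ (norm_nonneg f)).2 fun t => by
    simpa [g] using ContinuousMap.norm_coe_le_norm f t
  have hlp : ‖ContinuousMap.toLp (E := ℂ) 2 haarAddCircle ℂ g‖ ≤ ‖f‖ := by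
    have hnorm := ContinuousMap.toLp_norm_le (E := ℂ) (p := 2) (μ := haarAddCircle (T := T)) (𝕜 := ℂ)
    have huniv : measureUnivNNReal (haarAddCircle (T := T)) = 1 := by simp [measureUnivNNReal]
    rw [huniv] at hnorm
    simpa using ContinuousLinearMap.le_of_opNorm_le_of_le _ hnorm hg
  calc ∑ n ∈ s, circleCosCoeff n f ^ 2
      ≤ ∑ n ∈ s, ‖inner ℂ (fourierLp (T := T) 2 n)
          (ContinuousMap.toLp (E := ℂ) 2 haarAddCircle ℂ g)‖ ^ 2 := by
        refine Finset.sum_le_sum fun n _ => ?_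
        rw [ContinuousMap.inner_toLp, ← re_fourierCoeff, ← sq_abs]
        refine pow_le_pow_left₀ (abs_nonneg _) ((Complex.abs_re_le_norm _).trans_eq ?_) 2
        simp only [fourierCoeff, fourier_neg, smul_eq_mul, g, ContinuousMap.coe_mk, mul_comm]
    _ ≤ ‖ContinuousMap.toLp (E := ℂ) 2 haarAddCircle ℂ g‖ ^ 2 :=
        orthonormal_fourier.sum_inner_products_le _
    _ ≤ ‖f‖ ^ 2 := by gcongr

theorem sum_abs_mul_circleCosCoeff_le {m : ℤ → ℝ} (hm : Summable fun n => m n ^ 2)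
    (f : C(AddCircle T, ℝ)) (s : Finset ℤ) :
    ∑ n ∈ s, |m n * circleCosCoeff n f| ≤ √(∑' n, m n ^ 2) * ‖f‖ := by
  calc ∑ n ∈ s, |m n * circleCosCoeff n f|
      = ∑ n ∈ s, |m n| * |circleCosCoeff n f| := by simp only [abs_mul]
    _ ≤ √(∑ n ∈ s, |m n| ^ 2) * √(∑ n ∈ s, |circleCosCoeff n f| ^ 2) :=
        Real.sum_mul_le_sqrt_mul_sqrt _ _ _
    _ ≤ √(∑' n, m n ^ 2) * √(‖f‖ ^ 2) := by
        simp only [sq_abs]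
        gcongr
        · exact hm.sum_le_tsum s fun n _ => sq_nonneg _
        · exact sum_sq_circleCosCoeff_le f s
    _ = √(∑' n, m n ^ 2) * ‖f‖ := by rw [Real.sqrt_sq (norm_nonneg f)]

theorem summable_norm_circleCosMultiplier {m : ℤ → ℝ} (hm : Summable fun n => m n ^ 2)
    (f : C(AddCircle T, ℝ)) :
    Summable fun n => ‖(m n * circleCosCoeff n f) • circleCos (T := T) n‖ := by
  refine Summable.of_nonneg_of_le (fun _ => norm_nonneg _) (fun n => ?_)
    (summable_of_sum_le (fun n => abs_nonneg (m n * circleCosCoeff n f))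
      (sum_abs_mul_circleCosCoeff_le hm f))
  rw [norm_smul, Real.norm_eq_abs]
  exact mul_le_of_le_one_right (abs_nonneg _) (norm_circleCos_le n)

/-- The Fourier multiplier with square summable symbol `m`, composed with the projection onto
even functions. -/
noncomputable def circleCosMultiplier (m : ℤ → ℝ) (hm : Summable fun n => m n ^ 2) :
    C(AddCircle T, ℝ) →L[ℝ] C(AddCircle T, ℝ) :=
  LinearMap.mkContinuous
    { toFun := fun f => ∑' n, (m n * circleCosCoeff n f) • circleCos n
      map_add' := fun f g => by
        rw [← (summable_norm_circleCosMultiplier hm f).of_norm.tsum_add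
          (summable_norm_circleCosMultiplier hm g).of_norm]
        simp only [map_add, mul_add, add_smul]
      map_smul' := fun r f => by
        rw [RingHom.id_apply, ← (summable_norm_circleCosMultiplier hm f).of_norm.tsum_const_smul]
        simp only [map_smul, smul_eq_mul, smul_smul, mul_left_comm] }
    √(∑' n, m n ^ 2) fun f => by
      refine (norm_tsum_le_tsum_norm (summable_norm_circleCosMultiplier hm f)).trans ?_
      refine (summable_norm_circleCosMultiplier hm f).tsum_le_of_sum_le fun s =>
        (Finset.sum_le_sum fun n _ => ?_).trans (sum_abs_mul_circleCosCoeff_le hm f s)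
      rw [norm_smul, Real.norm_eq_abs]
      exact mul_le_of_le_one_right (abs_nonneg _) (norm_circleCos_le n)

theorem hasSum_circleCosMultiplier (m : ℤ → ℝ) (hm : Summable fun n => m n ^ 2)
    (f : C(AddCircle T, ℝ)) :
    HasSum (fun n => (m n * circleCosCoeff n f) • circleCos n) (circleCosMultiplier m hm f) :=
  (summable_norm_circleCosMultiplier hm f).of_norm.hasSum

theorem circleCosMultiplier_apply_neg (m : ℤ → ℝ) (hm : Summable fun n => m n ^ 2)
    (f : C(AddCircle T, ℝ)) (x : AddCircle T) :
    circleCosMultiplier m hm f (-x) = circleCosMultiplier m hm f x := by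
  have h (y : AddCircle T) := (ContinuousMap.evalCLM ℝ y).hasSum (hasSum_circleCosMultiplier m hm f)
  refine (h (-x)).unique ?_
  convert! h x using 2 with n
  simp [circleCos_apply_neg]

theorem circleCosCoeff_circleCosMultiplier (m : ℤ → ℝ) (hm : Summable fun n => m n ^ 2)
    (heven : ∀ n, m (-n) = m n) (f : C(AddCircle T, ℝ)) (n : ℤ) :
    circleCosCoeff n (circleCosMultiplier m hm f) = m n * circleCosCoeff n f := by
  have h := (circleCosCoeff (T := T) n).hasSum (hasSum_circleCosMultiplier m hm f)
  have h1 := hasSum_ite_eq (-n) (m n * circleCosCoeff n f / 2)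
  have h2 := hasSum_ite_eq n (m n * circleCosCoeff n f / 2)
  refine (h.unique ?_).trans (add_halves _)
  convert h1.add h2 using 2 with k
  rw [map_smul, circleCosCoeff_circleCos, smul_eq_mul]
  simp only [show n + k = 0 ↔ k = -n by omega, show n - k = 0 ↔ k = n by omega]
  split_ifs with h₁ h₂ h₂
  · rw [h₂]; ring
  · rw [h₁, heven, circleCosCoeff_neg]; ring
  · rw [h₂]; ring
  · ring

/-- The coefficient of an even function at `n` is its cosine coefficient. -/
theorem fourierCoeff_eq_circleCosCoeff (f : C(AddCircle T, ℝ)) (hf : ∀ x, f (-x) = f x) (n : ℤ) :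
    fourierCoeff (fun t => (f t : ℂ)) n = circleCosCoeff n f := by
  refine Complex.ext (re_fourierCoeff n f) ?_
  rw [Complex.ofReal_im, ← Complex.conj_eq_iff_im, fourierCoeff, ← integral_conj,
    ← integral_neg_eq_self _ haarAddCircle]
  refine integral_congr_ae (ae_of_all _ fun t => ?_)
  simp only [smul_eq_mul, map_mul, Complex.conj_ofReal, hf, fourier_apply, neg_neg, neg_smul,
    smul_neg]
  rw [fourier_neg', fourier_apply]

end Cosine

section Stokes

local instance : Fact (0 < 2 * Real.pi) := ⟨Real.two_pi_pos⟩

theorem fourierCoeff2pi_coe (f : C(AddCircle (2 * Real.pi), ℝ)) (n : ℤ) :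
    fourierCoeff2pi (fun x => f x) n = fourierCoeff (fun t => (f t : ℂ)) n := by
  rw [fourierCoeff_eq_intervalIntegral _ n (-Real.pi), fourierCoeff2pi,
    show -Real.pi + 2 * Real.pi = Real.pi by ring, Complex.real_smul]
  congr 1
  · push_cast; rfl
  · refine intervalIntegral.integral_congr fun x _ => ?_
    simp only [fourier_coe_apply, smul_eq_mul]
    rw [mul_comm]
    congr 2
    push_cast
    field_simp

/-- The inverse of the linearized symbol `1 - |n| ^ α`, vanishing on its kernel `n = ±1`. -/
noncomputable def stokesSymbol (α : ℝ) (n : ℤ) : ℝ :=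
  if |n| = 1 then 0 else (1 - |(n : ℝ)| ^ α)⁻¹

theorem stokesSymbol_neg (α : ℝ) (n : ℤ) : stokesSymbol α (-n) = stokesSymbol α n := by
  simp [stokesSymbol]

theorem three_halves_lt_two_rpow {α : ℝ} (hα : Real.log 3 / Real.log 2 - 1 < α) :
    (3 / 2 : ℝ) < 2 ^ α := by
  have h2 := Real.log_pos one_lt_two
  rw [← Real.log_lt_log_iff (by norm_num) (by positivity), Real.log_rpow two_pos,
    Real.log_div (by norm_num) (by norm_num)]
  calc Real.log 3 - Real.log 2 = (Real.log 3 / Real.log 2 - 1) * Real.log 2 := by field_simp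
    _ < α * Real.log 2 := by gcongr

theorem one_half_lt_of_three_halves_lt_two_rpow {α : ℝ} (h : (3 / 2 : ℝ) < 2 ^ α) : 1 / 2 < α := by
  rw [← Real.rpow_lt_rpow_left_iff one_lt_two, ← Real.sqrt_eq_rpow]
  refine lt_trans ?_ h
  rw [Real.sqrt_lt' (by norm_num)]
  norm_num

theorem three_halves_lt_abs_rpow {α : ℝ} (h : (3 / 2 : ℝ) < 2 ^ α) {n : ℤ} (hn : 2 ≤ |n|) :
    3 / 2 < |(n : ℝ)| ^ α := by
  refine h.trans_le (Real.rpow_le_rpow zero_le_two (by exact_mod_cast hn) ?_)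
  linarith [one_half_lt_of_three_halves_lt_two_rpow h]

theorem one_sub_abs_rpow_ne_zero {α : ℝ} (h : (3 / 2 : ℝ) < 2 ^ α) {n : ℤ} (hn : |n| ≠ 1) :
    1 - |(n : ℝ)| ^ α ≠ 0 := by
  have hα := one_half_lt_of_three_halves_lt_two_rpow h
  rcases eq_or_ne n 0 with rfl | hn0
  · simp [Real.zero_rpow (by linarith : α ≠ 0)]
  · have := three_halves_lt_abs_rpow h (n := n) (by have := abs_pos.2 hn0; omega)
    linarith

theorem summable_stokesSymbol_sq {α : ℝ} (h : (3 / 2 : ℝ) < 2 ^ α) :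
    Summable fun n => stokesSymbol α n ^ 2 := by
  have hα := one_half_lt_of_three_halves_lt_two_rpow h
  refine Summable.of_norm_bounded_eventually
    ((Real.summable_abs_int_rpow (b := 2 * α) (by linarith)).mul_left 9) ?_
  filter_upwards [(Set.finite_Icc (-1 : ℤ) 1).compl_mem_cofinite] with n hn
  have hn2 : 2 ≤ |n| := by
    simp only [Set.mem_compl_iff, Set.mem_Icc, not_and, not_le] at hn
    rw [le_abs]; omega
  have hpow := three_halves_lt_abs_rpow h hn2
  have hle : |stokesSymbol α n| ≤ 3 * (|(n : ℝ)| ^ α)⁻¹ := by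
    rw [stokesSymbol, if_neg (by omega), abs_inv, abs_of_neg (by linarith),
      ← div_eq_mul_inv, inv_le_comm₀ (by linarith) (by positivity), inv_div,
      div_le_iff₀ (by norm_num)]
    linarith
  rw [norm_pow, Real.norm_eq_abs]
  calc |stokesSymbol α n| ^ 2 ≤ (3 * (|(n : ℝ)| ^ α)⁻¹) ^ 2 := by gcongr
    _ = 9 * |(n : ℝ)| ^ (-(2 * α)) := by
      rw [Real.rpow_neg (abs_nonneg _), mul_comm 2 α, Real.rpow_mul (abs_nonneg _)]
      norm_num [mul_pow]

theorem two_mul_stokesSymbol_zero_add_pos {α : ℝ} (h : (3 / 2 : ℝ) < 2 ^ α) :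
    0 < 2 * stokesSymbol α 0 + stokesSymbol α 2 := by
  have hα := one_half_lt_of_three_halves_lt_two_rpow h
  have h0 : stokesSymbol α 0 = 1 := by
    simp [stokesSymbol, Real.zero_rpow (by linarith : α ≠ 0)]
  have h2 : stokesSymbol α 2 = -(2 ^ α - 1)⁻¹ := by
    rw [stokesSymbol, if_neg (by norm_num), ← inv_neg]
    norm_num
  have : (2 ^ α - 1)⁻¹ < (2 : ℝ) := by
    rw [inv_lt_comm₀ (by linarith) two_pos]; linarith
  rw [h0, h2]; linarith

/-- For `2 ^ α > 3 / 2` the bifurcation from `c = 1` along `cos x` is supercritical. -/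
theorem circleCosCoeff_one_cubic_pos {α : ℝ} (h : (3 / 2 : ℝ) < 2 ^ α)
    {e : C(AddCircle (2 * Real.pi), ℝ)} (he : e = (2 : ℝ) • circleCos 1) :
    0 < circleCosCoeff 1
      (e * circleCosMultiplier (stokesSymbol α) (summable_stokesSymbol_sq h) (e * e)) := by
  have hmul (n : ℤ) := circleCosCoeff_circleCosMultiplier (T := 2 * Real.pi) (stokesSymbol α)
    (summable_stokesSymbol_sq h) (stokesSymbol_neg α) (e * e) n
  have hcoeff (n : ℤ) : circleCosCoeff n (e * e) =
      2 * (circleCosCoeff n (circleCos (T := 2 * Real.pi) 2) +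
        circleCosCoeff n (circleCos (T := 2 * Real.pi) 0)) := by
    rw [he, smul_mul_smul_comm, circleCos_mul_circleCos, map_smul, map_smul, map_add]
    norm_num
    ring
  nth_rewrite 1 [he]
  rw [smul_mul_assoc, map_smul, circleCosCoeff_circleCos_mul, hmul, hmul, hcoeff, hcoeff]
  simp only [circleCosCoeff_circleCos]
  have := two_mul_stokesSymbol_zero_add_pos h
  norm_num
  linarith

/-- The reduced system yields all the cosine modes of the stationary equation. -/
theorem circleCosCoeff_stationary {α : ℝ} (h : (3 / 2 : ℝ) < 2 ^ α) {δ b : ℝ}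
    {e w : C(AddCircle (2 * Real.pi), ℝ)} (he : e = (2 : ℝ) • circleCos 1)
    (hb : b + circleCosCoeff 1 ((2 * b) • (e * w) + δ • (w * w)) = 0)
    (hw : w + circleCosMultiplier (stokesSymbol α) (summable_stokesSymbol_sq h)
      (δ ^ 2 • w + (b • e + δ • w) * (b • e + δ • w)) = 0) (n : ℤ) :
    (1 + δ ^ 2 - |(n : ℝ)| ^ α) * circleCosCoeff n (δ • (b • e + δ • w)) +
      circleCosCoeff n ((δ • (b • e + δ • w)) * (δ • (b • e + δ • w))) = 0 := by
  set Ψ := b • e + δ • w with hΨ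
  have hn := congrArg (circleCosCoeff n) hw
  rw [map_add, circleCosCoeff_circleCosMultiplier _ _ (stokesSymbol_neg α), map_add, map_smul,
    map_zero, smul_eq_mul, stokesSymbol] at hn
  rw [smul_mul_smul_comm, map_smul, map_smul, smul_eq_mul, smul_eq_mul]
  split_ifs at hn with hn1
  · have h1 (f : C(AddCircle (2 * Real.pi), ℝ)) : circleCosCoeff n f = circleCosCoeff 1 f := by
      rcases (abs_eq zero_le_one).1 hn1 with rfl | rfl
      · rfl
      · rw [circleCosCoeff_neg]
    have hr : |(n : ℝ)| = 1 := by exact_mod_cast hn1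
    have hee : circleCosCoeff 1 (e * e) = 0 := by
      rw [he, smul_mul_smul_comm, circleCos_mul_circleCos, map_smul, map_smul, map_add]
      norm_num [circleCosCoeff_circleCos]
    have he1 : circleCosCoeff 1 e = 1 := by
      rw [he, map_smul]; norm_num [circleCosCoeff_circleCos]
    have hΨΨ : Ψ * Ψ = (b * b) • (e * e) + δ • ((2 * b) • (e * w) + δ • (w * w)) := by
      ext x
      simp [hΨ]
      ring
    have hcoeff : circleCosCoeff 1 (Ψ * Ψ) =
        δ * circleCosCoeff 1 ((2 * b) • (e * w) + δ • (w * w)) := by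
      rw [hΨΨ, map_add, map_smul, map_smul, hee, smul_zero, zero_add, smul_eq_mul]
    rw [h1] at hn
    rw [h1, h1, hcoeff, hΨ, map_add, map_smul, map_smul, he1, hr, Real.one_rpow]
    simp only [smul_eq_mul]
    linear_combination δ ^ 3 * hb + δ ^ 4 * hn
  · have hne := one_sub_abs_rpow_ne_zero h hn1
    have he0 : circleCosCoeff n e = 0 := by
      rw [he, map_smul, circleCosCoeff_circleCos, if_neg, if_neg]
      · simp
      · rintro hn; exact hn1 (by rw [sub_eq_zero.1 hn, abs_one])
      · rintro hn; exact hn1 (by rw [eq_neg_of_add_eq_zero_left hn, abs_neg, abs_one])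
    have hn' : (1 - |(n : ℝ)| ^ α) * circleCosCoeff n w +
        (δ ^ 2 * circleCosCoeff n w + circleCosCoeff n (Ψ * Ψ)) = 0 := by
      field_simp at hn
      linear_combination hn
    have hΨn : circleCosCoeff n Ψ = δ * circleCosCoeff n w := by
      rw [hΨ, map_add, map_smul, map_smul, he0, smul_zero, zero_add, smul_eq_mul]
    rw [hΨn]
    linear_combination δ ^ 2 * hn'

end Stokes

theorem stmt3 (α : ℝ) (hα : Real.log 3 / Real.log 2 - 1 < α) (ε : ℝ) (hε : 0 < ε) :
    ∃ c₀ : ℝ, 1 < c₀ ∧ ∀ c : ℝ, 1 < c → c < c₀ →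
      ∃ φ : ℝ → ℝ, Continuous φ ∧ Function.Periodic φ (2 * Real.pi) ∧
        (∀ x, φ (-x) = φ x) ∧
        ¬ (∃ C : ℝ, ∀ x, φ x = C) ∧
        (⨆ x : ℝ, |φ x|) < ε ∧
        (∀ n : ℤ, ((c - |(n : ℝ)| ^ α : ℝ) : ℂ) * fourierCoeff2pi φ n
          + fourierCoeff2pi (fun x => (φ x) ^ 2) n = 0) := by
  have : Fact (0 < 2 * Real.pi) := ⟨Real.two_pi_pos⟩
  have h := three_halves_lt_two_rpow hα
  obtain ⟨e, he⟩ : ∃ e : C(AddCircle (2 * Real.pi), ℝ), e = (2 : ℝ) • circleCos 1 := ⟨_, rfl⟩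
  obtain ⟨η, hη, hsol⟩ := Metric.eventually_nhds_iff.1
    (eventually_exists_quadratic_bifurcation _ (circleCosCoeff 1) e
      (circleCosCoeff_one_cubic_pos h he) hε)
  refine ⟨1 + η ^ 2, by linarith [pow_pos hη 2], fun c hc hc' => ?_⟩
  have hδsq : √(c - 1) ^ 2 = c - 1 := Real.sq_sqrt (by linarith)
  have hδpos : 0 < √(c - 1) := Real.sqrt_pos.2 (by linarith)
  have hδlt : √(c - 1) < η := (Real.sqrt_lt' hη).2 (by linarith)
  set δ := √(c - 1)
  obtain ⟨b, w, hb, hsmall, hbeq, hweq⟩ := hsol (y := δ) (by simpa [abs_of_pos hδpos] using hδlt)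
  have hstat := circleCosCoeff_stationary h he hbeq hweq
  have hwcoeff : circleCosCoeff 1 w = 0 := by
    have := congrArg (circleCosCoeff 1) hweq
    rw [map_add, circleCosCoeff_circleCosMultiplier _ _ (stokesSymbol_neg α), stokesSymbol,
      if_pos abs_one, zero_mul, add_zero, map_zero] at this
    exact this
  have heven (x : AddCircle (2 * Real.pi)) :
      (δ • (b • e + δ • w)) (-x) = (δ • (b • e + δ • w)) x := by
    have hwx : w (-x) = w x := by
      rw [eq_neg_of_add_eq_zero_left hweq, ContinuousMap.neg_apply, ContinuousMap.neg_apply,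
        circleCosMultiplier_apply_neg]
    simp [hwx, he, circleCos_apply_neg]
  have hcoeff : circleCosCoeff 1 (δ • (b • e + δ • w)) = δ * b := by
    rw [map_smul, map_add, map_smul, map_smul, hwcoeff, he, map_smul, circleCosCoeff_circleCos]
    norm_num
  set Φ := δ • (b • e + δ • w)
  have hcast (x : ℝ) : |Φ x| ≤ ‖Φ‖ := ContinuousMap.norm_coe_le_norm Φ x
  refine ⟨fun x => Φ x, Φ.continuous.comp (AddCircle.continuous_mk' _), fun x => ?_, fun x => ?_,
    ?_, ?_, fun n => ?_⟩
  · simp only [AddCircle.coe_add_period]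
  · simpa using heven x
  · rintro ⟨C, hC⟩
    have hconst : Φ = C • circleCos 0 := by
      ext t
      induction t using QuotientAddGroup.induction_on with
      | H x => simpa [circleCos_apply] using hC x
    rw [hconst, map_smul, circleCosCoeff_circleCos] at hcoeff
    norm_num at hcoeff
    exact hcoeff.elim hδpos.ne' hb
  · exact (ciSup_le hcast).trans_lt hsmall
  · have hsq : fourierCoeff2pi (fun x => Φ x ^ 2) n = circleCosCoeff n (Φ * Φ) := by
      rw [← fourierCoeff_eq_circleCosCoeff _ (by simp [heven]), ← fourierCoeff2pi_coe]
      simp only [ContinuousMap.mul_apply, pow_two]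
    rw [fourierCoeff2pi_coe, fourierCoeff_eq_circleCosCoeff _ heven, hsq]
    have := hstat n
    rw [hδsq, add_sub_cancel] at this
    exact_mod_cast this
end

section
/- Let α > 0 and define φ₂(x) := −1/2 + cos(2x)/(2·(2^α − 1)) and, for a ∈ ℝ, φ_a(x) := a·cos x + a²·φ₂(x). Then for every a ∈ ℝ, ∫_{-π}^{π} φ_a(x)³ dx = (3π(3 − 2^{α+1})/(4(2^α − 1)))·a⁴ − (π/4 + 3π/(8(2^α − 1)²))·a⁶. In particular the coefficient of a⁴ equals (3π/(4(2^α − 1)))·(3 − 2^{α+1}), which is negative for α > log 3/log 2 − 1 and positive for 0 < α < log 3/log 2 − 1. -/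
open MeasureTheory Real

theorem integral_cos_pow_add_two_neg_pi_pi (n : ℕ) :
    (∫ x in (-Real.pi)..Real.pi, Real.cos x ^ (n + 2))
      = (n + 1) / (n + 2) * ∫ x in (-Real.pi)..Real.pi, Real.cos x ^ n := by
  rw [integral_cos_pow]
  simp

theorem integral_cube_quadratic_cos (a e f : ℝ) :
    (∫ x in (-Real.pi)..Real.pi, (e + a * Real.cos x + f * Real.cos x ^ 2) ^ 3)
      = 2 * Real.pi * e ^ 3 + Real.pi * (3 * e ^ 2 * f + 3 * e * a ^ 2)
        + 3 * Real.pi / 4 * (3 * e * f ^ 2 + 3 * a ^ 2 * f) + 5 * Real.pi / 8 * f ^ 3 := by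
  have h0 : (∫ x in (-Real.pi)..Real.pi, Real.cos x ^ 0) = 2 * Real.pi := by
    simp; ring
  have h1 : (∫ x in (-Real.pi)..Real.pi, Real.cos x ^ 1) = 0 := by simp
  have h2 := integral_cos_pow_add_two_neg_pi_pi 0
  have h3 := integral_cos_pow_add_two_neg_pi_pi 1
  have h4 := integral_cos_pow_add_two_neg_pi_pi 2
  have h5 := integral_cos_pow_add_two_neg_pi_pi 3
  have h6 := integral_cos_pow_add_two_neg_pi_pi 4
  rw [h0] at h2
  rw [h1] at h3
  norm_num only at h2 h3 h4 h5 h6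
  rw [h2] at h4
  rw [h3] at h5
  rw [h4] at h6
  let p : ℕ → ℝ := fun n => match n with
    | 0 => e ^ 3
    | 1 => 3 * a * e ^ 2
    | 2 => 3 * e ^ 2 * f + 3 * e * a ^ 2
    | 3 => a ^ 3 + 6 * e * a * f
    | 4 => 3 * e * f ^ 2 + 3 * a ^ 2 * f
    | 5 => 3 * a * f ^ 2
    | _ => f ^ 3
  have hp : ∀ x : ℝ, (e + a * Real.cos x + f * Real.cos x ^ 2) ^ 3
      = ∑ n ∈ Finset.range 7, p n * Real.cos x ^ n := by
    intro x
    simp only [Finset.sum_range_succ, Finset.sum_range_zero, p]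
    ring
  simp_rw [hp]
  rw [intervalIntegral.integral_finsetSum
    (fun n _ => Continuous.intervalIntegrable (by fun_prop) _ _)]
  simp only [intervalIntegral.integral_const_mul, Finset.sum_range_succ, Finset.sum_range_zero,
    h0, h1, h2, h3, h4, h5, h6, p]
  ring

theorem stmt4 (α : ℝ) (hα : 0 < α) :
    (∀ a : ℝ,
      (∫ x in (-Real.pi)..Real.pi,
          (a * Real.cos x
            + a ^ 2 * (-(1 / 2) + Real.cos (2 * x) / (2 * ((2 : ℝ) ^ α - 1)))) ^ 3)
        = (3 * Real.pi * (3 - (2 : ℝ) ^ (α + 1)) / (4 * ((2 : ℝ) ^ α - 1))) * a ^ 4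
          - (Real.pi / 4 + 3 * Real.pi / (8 * ((2 : ℝ) ^ α - 1) ^ 2)) * a ^ 6) ∧
    (Real.log 3 / Real.log 2 - 1 < α →
      (3 * Real.pi / (4 * ((2 : ℝ) ^ α - 1))) * (3 - (2 : ℝ) ^ (α + 1)) < 0) ∧
    (α < Real.log 3 / Real.log 2 - 1 →
      0 < (3 * Real.pi / (4 * ((2 : ℝ) ^ α - 1))) * (3 - (2 : ℝ) ^ (α + 1))) := by
  have hK : 0 < (2 : ℝ) ^ α - 1 := sub_pos.2 (Real.one_lt_rpow (by norm_num) hα)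
  have hlog : 0 < Real.log 2 := Real.log_pos (by norm_num)
  have hpos : 0 < 3 * Real.pi / (4 * ((2 : ℝ) ^ α - 1)) := by positivity
  refine ⟨fun a => ?_, fun h => ?_, fun h => ?_⟩
  · rw [Real.rpow_add_one (by norm_num)]
    have hK0 := hK.ne'
    obtain ⟨K, hKdef⟩ : ∃ K : ℝ, K = (2 : ℝ) ^ α - 1 := ⟨_, rfl⟩
    have h2 : (2 : ℝ) ^ α = K + 1 := by linarith
    rw [← hKdef] at hK0 ⊢
    rw [h2]
    have hint : ∀ x : ℝ, a * Real.cos x + a ^ 2 * (-(1 / 2) + Real.cos (2 * x) / (2 * K))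
        = a ^ 2 * (-(1 / 2) - 1 / (2 * K)) + a * Real.cos x + a ^ 2 / K * Real.cos x ^ 2 := by
      intro x
      rw [Real.cos_two_mul]
      field_simp
      ring
    simp_rw [hint]
    rw [integral_cube_quadratic_cos]
    field_simp
    ring
  · refine mul_neg_of_pos_of_neg hpos (sub_neg.2 ?_)
    rw [Real.lt_rpow_iff_log_lt (by norm_num) (by norm_num)]
    exact (div_lt_iff₀ hlog).1 (by linarith)
  · refine mul_pos hpos (sub_pos.2 ?_)
    rw [Real.rpow_lt_iff_lt_log (by norm_num) (by norm_num)]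
    exact (lt_div_iff₀ hlog).1 (by linarith)
end

section
/- Let α > 0 and define φ₂(x) := −1/2 + cos(2x)/(2·(2^α − 1)) and, for a ∈ ℝ, φ_a(x) := a·cos x + a²·φ₂(x). Then for every a ∈ ℝ, ∫_{-π}^{π} φ_a(x)·(φ_a′(x))² dx = (π(5 − 2^{α+1})/(4(2^α − 1)))·a⁴ − (π/(2(2^α − 1)²))·a⁶, where φ_a′ denotes the derivative of φ_a. In particular the coefficient of a⁴ equals (π/(4(2^α − 1)))·(5 − 2^{α+1}), which is negative for α > log 5/log 2 − 1 and positive for 0 < α < log 5/log 2 − 1. -/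
open MeasureTheory Real

/-- The integral over a full period of a polynomial of degree at most six in the cosine. -/
theorem integral_cos_polynomial_six (p₀ p₁ p₂ p₃ p₄ p₅ p₆ : ℝ) :
    (∫ x in (-Real.pi)..Real.pi,
        (p₀ + p₁ * Real.cos x + p₂ * Real.cos x ^ 2 + p₃ * Real.cos x ^ 3 + p₄ * Real.cos x ^ 4
          + p₅ * Real.cos x ^ 5 + p₆ * Real.cos x ^ 6))
      = 2 * Real.pi * (p₀ + p₂ / 2 + 3 * p₄ / 8 + 5 * p₆ / 16) := by
  let F : ℝ → ℝ := fun x =>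
    (p₀ + p₂ / 2 + 3 * p₄ / 8 + 5 * p₆ / 16) * x
      + Real.sin x * ((p₁ + 2 * p₃ / 3 + 8 * p₅ / 15)
        + (p₂ / 2 + 3 * p₄ / 8 + 5 * p₆ / 16) * Real.cos x
        + (p₃ / 3 + 4 * p₅ / 15) * Real.cos x ^ 2
        + (p₄ / 4 + 5 * p₆ / 24) * Real.cos x ^ 3
        + p₅ / 5 * Real.cos x ^ 4 + p₆ / 6 * Real.cos x ^ 5)
  rw [intervalIntegral.integral_eq_sub_of_hasDerivAt (f := F)]
  · simp only [F, Real.sin_neg, Real.sin_pi]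
    ring
  · intro x _
    have hc := Real.hasDerivAt_cos x
    have h := ((hasDerivAt_id x).const_mul (p₀ + p₂ / 2 + 3 * p₄ / 8 + 5 * p₆ / 16)).add
      ((Real.hasDerivAt_sin x).mul
        ((((((hc.const_mul (p₂ / 2 + 3 * p₄ / 8 + 5 * p₆ / 16)).const_add
          (p₁ + 2 * p₃ / 3 + 8 * p₅ / 15)).add
          ((hc.pow 2).const_mul (p₃ / 3 + 4 * p₅ / 15))).add
          ((hc.pow 3).const_mul (p₄ / 4 + 5 * p₆ / 24))).add
          ((hc.pow 4).const_mul (p₅ / 5))).add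
          ((hc.pow 5).const_mul (p₆ / 6))))
    refine h.congr_deriv ?_
    simp only [Pi.add_apply, Pi.pow_apply]
    push_cast
    ring_nf
    simp only [Real.sin_sq]
    ring
  · exact Continuous.intervalIntegrable (by fun_prop) _ _

theorem deriv_stokes_second_order (a D x : ℝ) :
    deriv (fun y : ℝ =>
        a * Real.cos y + a ^ 2 * (-(1 / 2) + Real.cos (2 * y) / (2 * D))) x
      = -(Real.sin x * (a + 4 * a ^ 2 * (1 / (2 * D)) * Real.cos x)) := by
  have h2 : HasDerivAt (fun y : ℝ => 2 * y) 2 x := by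
    simpa using (hasDerivAt_id x).const_mul (2 : ℝ)
  have h := ((Real.hasDerivAt_cos x).const_mul a).add
    (((h2.cos.div_const (2 * D)).const_add (-(1 / 2))).const_mul (a ^ 2))
  refine h.deriv.trans ?_
  rw [Real.sin_two_mul]
  ring

theorem stokes_integrand_eq_cos_polynomial (a k x : ℝ) :
    (a * Real.cos x + a ^ 2 * (-(1 / 2) + k * Real.cos (2 * x)))
        * (-(Real.sin x * (a + 4 * a ^ 2 * k * Real.cos x))) ^ 2
      = a ^ 4 * (-(1 / 2) - k)
        + (a ^ 3 + 8 * a ^ 5 * k * (-(1 / 2) - k)) * Real.cos x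
        + (10 * a ^ 4 * k + 16 * a ^ 6 * k ^ 2 * (-(1 / 2) - k) - a ^ 4 * (-(1 / 2) - k))
          * Real.cos x ^ 2
        + (32 * a ^ 5 * k ^ 2 - (a ^ 3 + 8 * a ^ 5 * k * (-(1 / 2) - k))) * Real.cos x ^ 3
        + (32 * a ^ 6 * k ^ 3 - (10 * a ^ 4 * k + 16 * a ^ 6 * k ^ 2 * (-(1 / 2) - k)))
          * Real.cos x ^ 4
        + -(32 * a ^ 5 * k ^ 2) * Real.cos x ^ 5
        + -(32 * a ^ 6 * k ^ 3) * Real.cos x ^ 6 := by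
  rw [Real.cos_two_mul, neg_sq, mul_pow, Real.sin_sq]
  ring

theorem stmt5 (α : ℝ) (hα : 0 < α) :
    (∀ a : ℝ,
      (∫ x in (-Real.pi)..Real.pi,
          (a * Real.cos x
            + a ^ 2 * (-(1 / 2) + Real.cos (2 * x) / (2 * ((2 : ℝ) ^ α - 1))))
          * (deriv (fun y : ℝ =>
              a * Real.cos y
                + a ^ 2 * (-(1 / 2) + Real.cos (2 * y) / (2 * ((2 : ℝ) ^ α - 1)))) x) ^ 2)
        = (Real.pi * (5 - (2 : ℝ) ^ (α + 1)) / (4 * ((2 : ℝ) ^ α - 1))) * a ^ 4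
          - (Real.pi / (2 * ((2 : ℝ) ^ α - 1) ^ 2)) * a ^ 6) ∧
    (Real.log 5 / Real.log 2 - 1 < α →
      (Real.pi / (4 * ((2 : ℝ) ^ α - 1))) * (5 - (2 : ℝ) ^ (α + 1)) < 0) ∧
    (α < Real.log 5 / Real.log 2 - 1 →
      0 < (Real.pi / (4 * ((2 : ℝ) ^ α - 1))) * (5 - (2 : ℝ) ^ (α + 1))) := by
  have hD : 0 < (2 : ℝ) ^ α - 1 := sub_pos.2 (Real.one_lt_rpow one_lt_two hα)
  have hlog : 0 < Real.log 2 := Real.log_pos one_lt_two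
  have hcoef : 0 < Real.pi / (4 * ((2 : ℝ) ^ α - 1)) := by positivity
  refine ⟨fun a => ?_, fun h => mul_neg_of_pos_of_neg hcoef (sub_neg.2 ?_),
    fun h => mul_pos hcoef (sub_pos.2 ?_)⟩
  · have hpow : (2 : ℝ) ^ (α + 1) = 2 * ((2 : ℝ) ^ α - 1) + 2 := by
      rw [Real.rpow_add_one two_ne_zero]
      ring
    rw [hpow]
    generalize (2 : ℝ) ^ α - 1 = D at hD
    simp only [deriv_stokes_second_order]
    simp only [div_eq_inv_mul (Real.cos _), inv_eq_one_div (2 * D),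
      stokes_integrand_eq_cos_polynomial]
    rw [integral_cos_polynomial_six]
    field_simp
    ring
  · rw [Real.lt_rpow_iff_log_lt (by norm_num) two_pos, ← div_lt_iff₀ hlog]
    linarith
  · rw [Real.rpow_lt_iff_lt_log two_pos (by norm_num), ← lt_div_iff₀ hlog]
    linarith
end

section
/- Define c(k) := (4 K(k)²/π²)·√(1 − k² + k⁴) for k ∈ (0,1). Then c is strictly increasing on (0,1), c(k) > 1 for every k ∈ (0,1), and c(k) → ∞ as k → 1⁻. -/
open MeasureTheory

/-- Complete elliptic integral of the first kind
`K(k) = ∫_0^{π/2} dθ/√(1 - k² sin²θ)`. -/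
noncomputable def ellipticK (k : ℝ) : ℝ :=
  ∫ θ in (0 : ℝ)..(Real.pi / 2), 1 / Real.sqrt (1 - k ^ 2 * Real.sin θ ^ 2)

/-- Speed of the 2π-periodic cnoidal wave of the KdV equation:
`c(k) = (4K(k)²/π²)·√(1 - k² + k⁴)`. -/
noncomputable def cnoidalSpeed (k : ℝ) : ℝ :=
  (4 * ellipticK k ^ 2 / Real.pi ^ 2) * Real.sqrt (1 - k ^ 2 + k ^ 4)

/-- The integrand of `K`, symmetrized under `θ ↦ π/2 - θ` and weighted by `(1 - m + m²)^(1/4)`,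
as a function of `m = k²` and `x = sin² θ`. -/
noncomputable def symmIntegrand (m x : ℝ) : ℝ :=
  √√(1 - m + m ^ 2) * (1 / √(1 - m * x) + 1 / √(1 - m * (1 - x)))

theorem one_sub_mul_pos {m x : ℝ} (hm : m ∈ Set.Ico (0 : ℝ) 1) (hx : x ∈ Set.Icc (0 : ℝ) 1) :
    0 < 1 - m * x := by
  nlinarith [hm.1, hm.2, hx.1, hx.2, mul_nonneg hm.1 (sub_nonneg.2 hx.2)]

theorem symmIntegrand_nonneg (m x : ℝ) : 0 ≤ symmIntegrand m x := by
  unfold symmIntegrand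
  positivity

theorem symmIntegrand_sq {m x : ℝ} (hm : m ∈ Set.Ico (0 : ℝ) 1) (hx : x ∈ Set.Icc (0 : ℝ) 1) :
    symmIntegrand m x ^ 2 =
      √(1 + (1 - x * (1 - x)) * (m ^ 2 / ((1 - m * x) * (1 - m * (1 - x))))) *
        (√(4 + (1 - 2 * x) ^ 2 * (m ^ 2 / ((1 - m * x) * (1 - m * (1 - x))))) + 2) := by
  have ha : 0 < 1 - m * x := one_sub_mul_pos hm hx
  have hb : 0 < 1 - m * (1 - x) := one_sub_mul_pos hm ⟨by linarith [hx.2], by linarith [hx.1]⟩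
  have hD : 0 ≤ 1 - m + m ^ 2 := by nlinarith [sq_nonneg (m - 1)]
  have hm2 : 0 ≤ 2 - m := by linarith [hm.2]
  have h₁ : 1 + (1 - x * (1 - x)) * (m ^ 2 / ((1 - m * x) * (1 - m * (1 - x)))) =
      (1 - m + m ^ 2) / ((1 - m * x) * (1 - m * (1 - x))) := by
    rw [eq_div_iff (mul_pos ha hb).ne', add_mul, mul_assoc, div_mul_cancel₀ _ (mul_pos ha hb).ne']
    ring
  have h₂ : 4 + (1 - 2 * x) ^ 2 * (m ^ 2 / ((1 - m * x) * (1 - m * (1 - x)))) =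
      (2 - m) ^ 2 / ((1 - m * x) * (1 - m * (1 - x))) := by
    rw [eq_div_iff (mul_pos ha hb).ne', add_mul, mul_assoc, div_mul_cancel₀ _ (mul_pos ha hb).ne']
    ring
  rw [h₁, h₂, Real.sqrt_div hD, Real.sqrt_div (sq_nonneg _), Real.sqrt_sq hm2,
    Real.sqrt_mul ha.le, symmIntegrand, mul_pow, Real.sq_sqrt (Real.sqrt_nonneg _)]
  have hsum : 2 - m = √(1 - m * x) ^ 2 + √(1 - m * (1 - x)) ^ 2 := by
    rw [Real.sq_sqrt ha.le, Real.sq_sqrt hb.le]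
    ring
  rw [hsum]
  have hsa := Real.sqrt_pos.2 ha
  have hsb := Real.sqrt_pos.2 hb
  field_simp
  ring

theorem symmIntegrand_lt {m n x : ℝ} (hm : 0 ≤ m) (hmn : m < n) (hn : n < 1)
    (hx : x ∈ Set.Icc (0 : ℝ) 1) : symmIntegrand m x < symmIntegrand n x := by
  have hm' : m ∈ Set.Ico (0 : ℝ) 1 := ⟨hm, hmn.trans hn⟩
  have hn' : n ∈ Set.Ico (0 : ℝ) 1 := ⟨hm.trans hmn.le, hn⟩
  have hx' : 1 - x ∈ Set.Icc (0 : ℝ) 1 := ⟨by linarith [hx.2], by linarith [hx.1]⟩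
  have ha := one_sub_mul_pos hn' hx
  have hb := one_sub_mul_pos hn' hx'
  have ht : m ^ 2 / ((1 - m * x) * (1 - m * (1 - x))) <
      n ^ 2 / ((1 - n * x) * (1 - n * (1 - x))) := by
    have hx₀ := hx.1
    have hx₁ := hx'.1
    apply div_lt_div₀ (by gcongr) _ (sq_nonneg n) (by positivity)
    gcongr
    exact (one_sub_mul_pos hm' hx).le
  have hq : 0 < 1 - x * (1 - x) := by nlinarith [sq_nonneg (2 * x - 1)]
  have hs : 0 ≤ m ^ 2 / ((1 - m * x) * (1 - m * (1 - x))) :=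
    div_nonneg (sq_nonneg m)
      (mul_pos (one_sub_mul_pos hm' hx) (one_sub_mul_pos hm' hx')).le
  refine lt_of_pow_lt_pow_left₀ 2 (symmIntegrand_nonneg n x) ?_
  rw [symmIntegrand_sq hm' hx, symmIntegrand_sq hn' hx]
  refine mul_lt_mul (Real.sqrt_lt_sqrt (by positivity) (by gcongr)) ?_ (by positivity)
    (Real.sqrt_nonneg _)
  gcongr

theorem sin_sq_mem_Icc (θ : ℝ) : Real.sin θ ^ 2 ∈ Set.Icc (0 : ℝ) 1 :=
  ⟨sq_nonneg _, Real.sin_sq_le_one θ⟩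

theorem sq_mem_Ico {k : ℝ} (hk : k ∈ Set.Ico (0 : ℝ) 1) : k ^ 2 ∈ Set.Ico (0 : ℝ) 1 :=
  ⟨sq_nonneg k, by nlinarith [hk.1, hk.2]⟩

theorem continuous_one_div_sqrt_one_sub {m : ℝ} (hm : m ∈ Set.Ico (0 : ℝ) 1) {f : ℝ → ℝ}
    (hf : Continuous f) (hf' : ∀ θ, f θ ∈ Set.Icc (0 : ℝ) 1) :
    Continuous fun θ => 1 / √(1 - m * f θ) :=
  continuous_const.div (by fun_prop) fun θ =>
    (Real.sqrt_pos.2 (one_sub_mul_pos hm (hf' θ))).ne'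

theorem continuous_symmIntegrand {m : ℝ} (hm : m ∈ Set.Ico (0 : ℝ) 1) :
    Continuous fun θ => symmIntegrand m (Real.sin θ ^ 2) := by
  refine continuous_const.mul ((continuous_one_div_sqrt_one_sub hm (by fun_prop)
    sin_sq_mem_Icc).add (continuous_one_div_sqrt_one_sub hm (by fun_prop) fun θ => ?_))
  exact ⟨by linarith [(sin_sq_mem_Icc θ).2], by linarith [(sin_sq_mem_Icc θ).1]⟩

theorem integral_symmIntegrand {k : ℝ} (hk : k ∈ Set.Ico (0 : ℝ) 1) :
    ∫ θ in (0 : ℝ)..(Real.pi / 2), symmIntegrand (k ^ 2) (Real.sin θ ^ 2) =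
      √√(1 - k ^ 2 + k ^ 4) * (2 * ellipticK k) := by
  have hreflect : ∫ θ in (0 : ℝ)..(Real.pi / 2), 1 / √(1 - k ^ 2 * (1 - Real.sin θ ^ 2)) =
      ellipticK k := by
    have h := intervalIntegral.integral_comp_sub_left (a := 0) (b := Real.pi / 2)
      (fun θ => 1 / √(1 - k ^ 2 * Real.sin θ ^ 2)) (Real.pi / 2)
    simp only [Real.sin_pi_div_two_sub, Real.cos_sq', sub_self, sub_zero] at h
    exact h
  have hc := continuous_one_div_sqrt_one_sub (sq_mem_Ico hk)
    (f := fun θ => Real.sin θ ^ 2) (by fun_prop) sin_sq_mem_Icc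
  have hc' := continuous_one_div_sqrt_one_sub (sq_mem_Ico hk)
    (f := fun θ => 1 - Real.sin θ ^ 2) (by fun_prop) fun θ =>
      ⟨by linarith [(sin_sq_mem_Icc θ).2], by linarith [(sin_sq_mem_Icc θ).1]⟩
  simp only [symmIntegrand]
  rw [intervalIntegral.integral_const_mul, intervalIntegral.integral_add
    (hc.intervalIntegrable _ _) (hc'.intervalIntegrable _ _), hreflect, ← pow_mul, two_mul (ellipticK k)]
  rfl

theorem cnoidalSpeed_eq_sq {k : ℝ} (hk : k ∈ Set.Ico (0 : ℝ) 1) :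
    cnoidalSpeed k = (∫ θ in (0 : ℝ)..(Real.pi / 2),
      symmIntegrand (k ^ 2) (Real.sin θ ^ 2)) ^ 2 / Real.pi ^ 2 := by
  rw [integral_symmIntegrand hk, mul_pow, Real.sq_sqrt (Real.sqrt_nonneg _), cnoidalSpeed]
  ring

theorem strictMonoOn_cnoidalSpeed : StrictMonoOn cnoidalSpeed (Set.Ico 0 1) := by
  intro k hk l hl hkl
  have hk₀ := hk.1
  have hpi := Real.pi_div_two_pos
  have hlt (θ : ℝ) : symmIntegrand (k ^ 2) (Real.sin θ ^ 2) <
      symmIntegrand (l ^ 2) (Real.sin θ ^ 2) :=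
    symmIntegrand_lt (sq_nonneg k) (by gcongr) (sq_mem_Ico hl).2 (sin_sq_mem_Icc θ)
  rw [cnoidalSpeed_eq_sq hk, cnoidalSpeed_eq_sq hl]
  gcongr
  · exact intervalIntegral.integral_nonneg hpi.le fun θ _ => symmIntegrand_nonneg _ _
  · exact intervalIntegral.integral_lt_integral_of_continuousOn_of_le_of_exists_lt hpi
      (continuous_symmIntegrand (sq_mem_Ico hk)).continuousOn
      (continuous_symmIntegrand (sq_mem_Ico hl)).continuousOn
      (fun θ _ => (hlt θ).le) ⟨0, ⟨le_rfl, hpi.le⟩, hlt 0⟩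

theorem cnoidalSpeed_zero : cnoidalSpeed 0 = 1 := by
  have := Real.pi_pos
  simp [cnoidalSpeed, ellipticK]
  field_simp
  norm_num

theorem log_le_ellipticK {k : ℝ} (hk : k ∈ Set.Ico (0 : ℝ) 1) :
    Real.log (Real.pi / 2 / √(1 - k ^ 2)) ≤ ellipticK k := by
  have hpi := Real.pi_div_two_pos
  have hk' : 0 < 1 - k ^ 2 := by linarith [(sq_mem_Ico hk).2]
  have hε : 0 < √(1 - k ^ 2) := Real.sqrt_pos.2 hk'
  set ε := √(1 - k ^ 2) with hεdef
  have hint : ∫ θ in (0 : ℝ)..(Real.pi / 2), 1 / (Real.pi / 2 - θ + ε) =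
      Real.log ((Real.pi / 2 + ε) / ε) := by
    rw [intervalIntegral.integral_comp_sub_left (fun u => 1 / (u + ε)),
      intervalIntegral.integral_comp_add_right (fun u => 1 / u), integral_one_div_of_pos]
    · simp
    · simpa using hε
    · simpa using by positivity
  calc Real.log (Real.pi / 2 / ε) ≤ Real.log ((Real.pi / 2 + ε) / ε) := by
        gcongr
        linarith
    _ = ∫ θ in (0 : ℝ)..(Real.pi / 2), 1 / (Real.pi / 2 - θ + ε) := hint.symm
    _ ≤ ellipticK k := by
      refine intervalIntegral.integral_mono_on hpi.le ?_
        ((continuous_one_div_sqrt_one_sub (sq_mem_Ico hk) (by fun_prop)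
          sin_sq_mem_Icc).intervalIntegrable _ _) fun θ hθ => ?_
      · refine ContinuousOn.intervalIntegrable_of_Icc hpi.le
          (continuousOn_const.div (by fun_prop) fun θ hθ => ?_)
        linarith [hθ.2]
      · have hu : 0 ≤ Real.pi / 2 - θ := sub_nonneg.2 hθ.2
        have hcos : Real.cos θ ≤ Real.pi / 2 - θ := by
          rw [← Real.sin_pi_div_two_sub]
          exact Real.sin_le hu
        have hcos₀ : 0 ≤ Real.cos θ :=
          Real.cos_nonneg_of_mem_Icc ⟨by linarith [hθ.1], hθ.2⟩
        have hεsq : ε ^ 2 = 1 - k ^ 2 := Real.sq_sqrt hk'.le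
        apply one_div_le_one_div_of_le
          (Real.sqrt_pos.2 (one_sub_mul_pos (sq_mem_Ico hk) (sin_sq_mem_Icc θ)))
        rw [Real.sqrt_le_left (by positivity)]
        nlinarith [Real.sin_sq_add_cos_sq θ, mul_nonneg hu hε.le,
          mul_nonneg hk'.le (sq_nonneg (Real.cos θ)), pow_le_pow_left₀ hcos₀ hcos 2]

theorem tendsto_ellipticK_atTop :
    Filter.Tendsto ellipticK (nhdsWithin 1 (Set.Iio 1)) Filter.atTop := by
  have hmem : Set.Ioo (0 : ℝ) 1 ∈ nhdsWithin 1 (Set.Iio 1) := Ioo_mem_nhdsLT zero_lt_one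
  have hsqrt : Filter.Tendsto (fun k : ℝ => √(1 - k ^ 2)) (nhdsWithin 1 (Set.Iio 1))
      (nhdsWithin 0 (Set.Ioi 0)) := by
    refine tendsto_nhdsWithin_iff.2 ⟨?_, ?_⟩
    · have h : Continuous fun k : ℝ => √(1 - k ^ 2) := by fun_prop
      simpa using (h.tendsto 1).mono_left nhdsWithin_le_nhds
    · filter_upwards [hmem] with k hk
      exact Real.sqrt_pos.2 (by linarith [(sq_mem_Ico ⟨hk.1.le, hk.2⟩).2])
  have hlog := Real.tendsto_log_atTop.comp
    ((tendsto_inv_nhdsGT_zero.comp hsqrt).const_mul_atTop Real.pi_div_two_pos)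
  refine Filter.tendsto_atTop_mono' _ ?_ hlog
  filter_upwards [hmem] with k hk
  exact log_le_ellipticK ⟨hk.1.le, hk.2⟩

theorem tendsto_cnoidalSpeed_atTop :
    Filter.Tendsto cnoidalSpeed (nhdsWithin 1 (Set.Iio 1)) Filter.atTop := by
  have hsqrt : Filter.Tendsto (fun k : ℝ => √(1 - k ^ 2 + k ^ 4)) (nhdsWithin 1 (Set.Iio 1))
      (nhds 1) := by
    have h : Continuous fun k : ℝ => √(1 - k ^ 2 + k ^ 4) := by fun_prop
    simpa using (h.tendsto 1).mono_left nhdsWithin_le_nhds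
  have hK := (Filter.tendsto_pow_atTop two_ne_zero).comp tendsto_ellipticK_atTop
  exact ((hK.const_mul_atTop four_pos).atTop_div_const (pow_pos Real.pi_pos 2)).atTop_mul_pos
    one_pos hsqrt

theorem stmt6 :
    StrictMonoOn cnoidalSpeed (Set.Ioo 0 1) ∧
    (∀ k ∈ Set.Ioo (0 : ℝ) 1, 1 < cnoidalSpeed k) ∧
    Filter.Tendsto cnoidalSpeed (nhdsWithin 1 (Set.Iio 1)) Filter.atTop := by
  refine ⟨strictMonoOn_cnoidalSpeed.mono Set.Ioo_subset_Ico_self, fun k hk => ?_,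
    tendsto_cnoidalSpeed_atTop⟩
  rw [← cnoidalSpeed_zero]
  exact strictMonoOn_cnoidalSpeed ⟨le_rfl, one_pos⟩ ⟨hk.1.le, hk.2⟩ hk.1
end

section
/- Define I(k) := 2(1 − k² + k⁴)·E(k) − (2 − 3k² + k⁴)·K(k) for k ∈ (0,1). Then I(k) > 0 for every k ∈ (0,1). -/
open MeasureTheory

/-- Complete elliptic integral of the second kind
`E(k) = ∫_0^{π/2} √(1 - k² sin²θ) dθ`. -/
noncomputable def ellipticE (k : ℝ) : ℝ :=
  ∫ θ in (0 : ℝ)..(Real.pi / 2), Real.sqrt (1 - k ^ 2 * Real.sin θ ^ 2)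

lemma one_sub_sq_mul_sin_sq_pos {k : ℝ} (hk : k ∈ Set.Ioo (0 : ℝ) 1) (θ : ℝ) :
    0 < 1 - k ^ 2 * Real.sin θ ^ 2 := by
  have hk2 : k ^ 2 < 1 := by nlinarith [hk.1, hk.2]
  nlinarith [Real.sin_sq_le_one θ, sq_nonneg k]

/-- The derivative of the primitive relating `ellipticE`, `ellipticK` and
`∫ sin² θ cos² θ √(1 - k² sin² θ)`. -/
lemma hasDerivAt_ellipticPrimitive {k : ℝ} (hk : k ∈ Set.Ioo (0 : ℝ) 1) (θ : ℝ) :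
    HasDerivAt
      (fun t ↦ Real.sin t * Real.cos t * Real.sqrt (1 - k ^ 2 * Real.sin t ^ 2) *
        (k ^ 2 + k ^ 4 - 3 * k ^ 4 * Real.sin t ^ 2))
      (2 * (1 - k ^ 2 + k ^ 4) * Real.sqrt (1 - k ^ 2 * Real.sin θ ^ 2) -
        (2 - 3 * k ^ 2 + k ^ 4) * (1 / Real.sqrt (1 - k ^ 2 * Real.sin θ ^ 2)) -
        15 * k ^ 4 *
          (Real.sin θ ^ 2 * Real.cos θ ^ 2 * Real.sqrt (1 - k ^ 2 * Real.sin θ ^ 2))) θ := by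
  have hpos := one_sub_sq_mul_sin_sq_pos hk θ
  have hs := Real.hasDerivAt_sin θ
  have hsq := hs.pow 2
  have hrad := ((hsq.const_mul (k ^ 2)).const_sub 1).sqrt hpos.ne'
  have hmain := ((hs.mul (Real.hasDerivAt_cos θ)).mul hrad).mul
    ((hsq.const_mul (3 * k ^ 4)).const_sub (k ^ 2 + k ^ 4))
  refine hmain.congr_deriv ?_
  simp only [Pi.mul_apply, Pi.pow_apply]
  have hd : Real.sqrt (1 - k ^ 2 * Real.sin θ ^ 2) ≠ 0 := (Real.sqrt_pos.2 hpos).ne'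
  have hd2 := Real.sq_sqrt hpos.le
  have hc := Real.cos_sq' θ
  generalize Real.sqrt (1 - k ^ 2 * Real.sin θ ^ 2) = d at *
  generalize Real.sin θ = s at *
  generalize Real.cos θ = c at *
  field_simp
  ring_nf
  simp only [hd2, hc]
  ring

/-- The reduction formula expressing `∫ sin² θ cos² θ √(1 - k² sin² θ)` through complete elliptic
integrals. -/
lemma ellipticE_ellipticK_reduction {k : ℝ} (hk : k ∈ Set.Ioo (0 : ℝ) 1) :
    2 * (1 - k ^ 2 + k ^ 4) * ellipticE k - (2 - 3 * k ^ 2 + k ^ 4) * ellipticK k =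
      15 * k ^ 4 * ∫ θ in (0 : ℝ)..(Real.pi / 2),
        Real.sin θ ^ 2 * Real.cos θ ^ 2 * Real.sqrt (1 - k ^ 2 * Real.sin θ ^ 2) := by
  have hE : Continuous fun θ ↦ Real.sqrt (1 - k ^ 2 * Real.sin θ ^ 2) := by fun_prop
  have hK : Continuous fun θ ↦ 1 / Real.sqrt (1 - k ^ 2 * Real.sin θ ^ 2) :=
    continuous_const.div hE fun θ ↦ (Real.sqrt_pos.2 (one_sub_sq_mul_sin_sq_pos hk θ)).ne'
  have hJ : Continuous fun θ ↦
      Real.sin θ ^ 2 * Real.cos θ ^ 2 * Real.sqrt (1 - k ^ 2 * Real.sin θ ^ 2) := by fun_prop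
  have hEi := (hE.const_mul (2 * (1 - k ^ 2 + k ^ 4))).intervalIntegrable
    (μ := volume) 0 (Real.pi / 2)
  have hKi := (hK.const_mul (2 - 3 * k ^ 2 + k ^ 4)).intervalIntegrable
    (μ := volume) 0 (Real.pi / 2)
  have hJi := (hJ.const_mul (15 * k ^ 4)).intervalIntegrable (μ := volume) 0 (Real.pi / 2)
  have h := intervalIntegral.integral_eq_sub_of_hasDerivAt
    (fun θ _ ↦ hasDerivAt_ellipticPrimitive hk θ) ((hEi.sub hKi).sub hJi)
  rw [intervalIntegral.integral_sub (hEi.sub hKi) hJi, intervalIntegral.integral_sub hEi hKi,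
    intervalIntegral.integral_const_mul, intervalIntegral.integral_const_mul,
    intervalIntegral.integral_const_mul] at h
  simp only [Real.sin_zero, Real.cos_pi_div_two, zero_mul, mul_zero, sub_zero] at h
  exact sub_eq_zero.1 h

theorem stmt7 (k : ℝ) (hk : k ∈ Set.Ioo (0 : ℝ) 1) :
    0 < 2 * (1 - k ^ 2 + k ^ 4) * ellipticE k - (2 - 3 * k ^ 2 + k ^ 4) * ellipticK k := by
  rw [ellipticE_ellipticK_reduction hk]
  refine mul_pos (mul_pos (by norm_num) (pow_pos hk.1 4)) ?_
  refine intervalIntegral.intervalIntegral_pos_of_pos_on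
    (Continuous.intervalIntegrable (by fun_prop) _ _) (fun θ hθ ↦ ?_) Real.pi_div_two_pos
  have hs : 0 < Real.sin θ :=
    Real.sin_pos_of_pos_of_lt_pi hθ.1 (by linarith [hθ.2, Real.pi_pos])
  have hc : 0 < Real.cos θ := Real.cos_pos_of_mem_Ioo ⟨by linarith [hθ.1, Real.pi_pos], hθ.2⟩
  have hd := Real.sqrt_pos.2 (one_sub_sq_mul_sin_sq_pos hk θ)
  positivity
end

section
/- Let c > 0 and let φ : ℝ → ℝ be a twice continuously differentiable, 2π-periodic, nonconstant function satisfying c·φ(x) + φ″(x) + φ(x)² = 0 for every x ∈ ℝ. Then ∫_{-π}^{π} φ(x)·(φ′(x))² dx < 0. -/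
open MeasureTheory

/-- The derivative of a periodic function is periodic. -/
lemma Function.Periodic.deriv_periodic {f : ℝ → ℝ} {T : ℝ} (hf : Function.Periodic f T) :
    Function.Periodic (deriv f) T := by
  intro x
  rw [← deriv_comp_add_const, show (fun y => f (y + T)) = f from funext hf]

/-- A differentiable real function with `f * f' = 0` everywhere is constant. -/
lemma exists_eq_const_of_mul_deriv_eq_zero {f : ℝ → ℝ} (hf : Differentiable ℝ f)
    (h : ∀ x, f x * deriv f x = 0) : ∃ C : ℝ, ∀ x, f x = C := by
  have hsq : ∀ x y, f x ^ 2 = f y ^ 2 := by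
    refine is_const_of_deriv_eq_zero (f := fun x => f x ^ 2) (hf.pow 2) fun x => ?_
    have hd := ((hf x).hasDerivAt.pow 2).deriv
    refine hd.trans ?_
    linear_combination 2 * h x
  by_cases h0 : f 0 = 0
  · refine ⟨0, fun x => ?_⟩
    have := hsq x 0
    simpa [h0] using this
  · refine ⟨f 0, fun x => is_const_of_deriv_eq_zero hf (fun y => ?_) x 0⟩
    refine (mul_eq_zero.mp (h y)).resolve_left fun hy => h0 ?_
    have := hsq 0 y
    simpa [hy] using this

theorem stmt10 (c : ℝ) (hc : 0 < c) (φ : ℝ → ℝ)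
    (hsmooth : ContDiff ℝ 2 φ)
    (hper : Function.Periodic φ (2 * Real.pi))
    (hnc : ¬ (∃ C : ℝ, ∀ x, φ x = C))
    (heq : ∀ x : ℝ, c * φ x + deriv (deriv φ) x + (φ x) ^ 2 = 0) :
    (∫ x in (-Real.pi)..Real.pi, φ x * (deriv φ x) ^ 2) < 0 := by
  have hφ : Differentiable ℝ φ := hsmooth.differentiable (by norm_num)
  have hd : ContDiff ℝ 1 (deriv φ) :=
    (contDiff_succ_iff_deriv.mp (by simpa [one_add_one_eq_two] using hsmooth)).2.2
  have hdd : Differentiable ℝ (deriv φ) := hd.differentiable (by norm_num)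
  have hcφ := hφ.continuous
  have hcd := hdd.continuous
  have hcdd : Continuous (deriv (deriv φ)) := hd.continuous_deriv le_rfl
  have hperd := hper.deriv_periodic
  have hzero : ∫ x in (-Real.pi)..Real.pi, 3 * deriv φ x ^ 2 * deriv (deriv φ) x = 0 := by
    rw [intervalIntegral.integral_eq_sub_of_hasDerivAt (f := fun x => deriv φ x ^ 3)]
    · have := hperd (-Real.pi)
      rw [show -Real.pi + 2 * Real.pi = Real.pi by ring] at this
      simp [this]
    · intro x _
      simpa using (hdd x).hasDerivAt.fun_pow 3
    · exact (by fun_prop : Continuous _).intervalIntegrable _ _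
  have hpos : 0 < ∫ x in (-Real.pi)..Real.pi, (φ x * deriv φ x) ^ 2 := by
    have hne : ∃ x, φ x * deriv φ x ≠ 0 := by
      by_contra! h
      exact hnc (exists_eq_const_of_mul_deriv_eq_zero hφ h)
    obtain ⟨x, hx⟩ := hne
    obtain ⟨y, hy, hxy⟩ :=
      (hper.mul hperd).exists_mem_Ico Real.two_pi_pos x (-Real.pi)
    refine intervalIntegral.integral_pos (by linarith [Real.pi_pos])
      (by fun_prop) (fun _ _ => sq_nonneg _) ⟨y, ⟨hy.1, by linarith [hy.2]⟩, ?_⟩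
    have : φ y * deriv φ y ≠ 0 := by
      change (φ * deriv φ) y ≠ 0
      rwa [← hxy]
    positivity
  have hsum : c * (∫ x in (-Real.pi)..Real.pi, φ x * (deriv φ x) ^ 2) =
      -(1 / 3) * (∫ x in (-Real.pi)..Real.pi, 3 * deriv φ x ^ 2 * deriv (deriv φ) x) -
        ∫ x in (-Real.pi)..Real.pi, (φ x * deriv φ x) ^ 2 := by
    rw [← intervalIntegral.integral_const_mul, ← intervalIntegral.integral_const_mul,
      ← intervalIntegral.integral_sub ((by fun_prop : Continuous _).intervalIntegrable _ _)
        ((by fun_prop : Continuous _).intervalIntegrable _ _)]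
    refine intervalIntegral.integral_congr fun x _ => ?_
    linear_combination deriv φ x ^ 2 * heq x
  rw [hzero] at hsum
  nlinarith
end

section
/- Let γ > 0, c := coth γ, and φ_γ(x) := (cosh γ · cos x − 1)/(sinh γ · (cosh γ − cos x)). Then φ_γ is a continuous 2π-periodic function that solves the stationary Benjamin–Ono equation (c + D₁)φ + φ² = 0: for every n ∈ ℤ one has (c − |n|)·φ̂_γ(n) + (φ_γ²)̂(n) = 0. -/
open MeasureTheory

/-- The 2π-periodic Benjamin–Ono travelling wave profile with parameter `γ`. -/
noncomputable def boWave (γ : ℝ) (x : ℝ) : ℝ :=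
  (Real.cosh γ * Real.cos x - 1) / (Real.sinh γ * (Real.cosh γ - Real.cos x))

/-- The harmonic conjugate of the Poisson kernel `sinh γ / (cosh γ - cos x)`. -/
noncomputable def conjugatePoisson (γ x : ℝ) : ℝ :=
  Real.sin x / (Real.cosh γ - Real.cos x)

lemma cosh_sub_cos_pos {γ : ℝ} (hγ : 0 < γ) (x : ℝ) : 0 < Real.cosh γ - Real.cos x := by
  have := Real.one_lt_cosh.2 hγ.ne'
  linarith [Real.cos_le_one x]

lemma continuous_boWave {γ : ℝ} (hγ : 0 < γ) : Continuous (boWave γ) := by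
  have hS := Real.sinh_pos_iff.2 hγ
  unfold boWave
  exact Continuous.div (by fun_prop) (by fun_prop)
    fun x => (mul_pos hS (cosh_sub_cos_pos hγ x)).ne'

lemma continuous_conjugatePoisson {γ : ℝ} (hγ : 0 < γ) : Continuous (conjugatePoisson γ) := by
  unfold conjugatePoisson
  exact Continuous.div (by fun_prop) (by fun_prop) fun x => (cosh_sub_cos_pos hγ x).ne'

lemma periodic_boWave (γ : ℝ) : Function.Periodic (boWave γ) (2 * Real.pi) := by
  intro x
  simp [boWave]

lemma boWave_neg (γ x : ℝ) : boWave γ (-x) = boWave γ x := by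
  simp [boWave]

lemma hasDerivAt_conjugatePoisson {γ : ℝ} (hγ : 0 < γ) (x : ℝ) :
    HasDerivAt (conjugatePoisson γ)
      (Real.cosh γ / Real.sinh γ * boWave γ x + boWave γ x ^ 2) x := by
  have hS := (Real.sinh_pos_iff.2 hγ).ne'
  have hD := (cosh_sub_cos_pos hγ x).ne'
  refine ((Real.hasDerivAt_sin x).div
    ((Real.hasDerivAt_cos x).const_sub (Real.cosh γ)) hD).congr_deriv ?_
  unfold boWave
  field_simp
  linear_combination (1 - Real.cosh γ * Real.cos x) * Real.cosh_sq γ -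
    Real.sinh γ ^ 2 * Real.sin_sq_add_cos_sq x

lemma fourierCoeff2pi_neg_of_even {f : ℝ → ℝ} (hf : ∀ x, f (-x) = f x) (n : ℤ) :
    fourierCoeff2pi f (-n) = fourierCoeff2pi f n := by
  unfold fourierCoeff2pi
  have h := intervalIntegral.integral_comp_neg (a := -Real.pi) (b := Real.pi)
    (fun x : ℝ => (f x : ℂ) * Complex.exp (-(Complex.I * (n : ℂ) * (x : ℂ))))
  rw [neg_neg] at h
  rw [← h]
  simp [hf]

lemma boWave_add_I_mul_conjugatePoisson {γ : ℝ} (hγ : 0 < γ) (x : ℝ) :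
    (boWave γ x : ℂ) + Complex.I * conjugatePoisson γ x =
      (Complex.exp γ + Complex.exp (Complex.I * x)) / (Complex.exp γ - Complex.exp (Complex.I * x))
        - Complex.cosh γ / Complex.sinh γ := by
  have hS : Complex.sinh γ ≠ 0 := by
    exact_mod_cast (Real.sinh_pos_iff.2 hγ).ne'
  have hD : Complex.cosh γ - Complex.cos x ≠ 0 := by
    exact_mod_cast (cosh_sub_cos_pos hγ x).ne'
  have hz : Complex.exp (Complex.I * x) = Complex.cos x + Complex.sin x * Complex.I := by
    rw [mul_comm, Complex.exp_mul_I]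
  have hne : Complex.exp γ - Complex.exp (Complex.I * x) ≠ 0 := by
    intro h
    have h1 : ‖Complex.exp (γ : ℂ)‖ = ‖Complex.exp (Complex.I * x)‖ := by rw [sub_eq_zero.1 h]
    simp [Complex.norm_exp, hγ.ne'] at h1
  rw [hz, ← Complex.cosh_add_sinh] at hne ⊢
  unfold boWave conjugatePoisson
  push_cast
  have h1 := Complex.cosh_sq (γ : ℂ)
  have h2 := Complex.sin_sq_add_cos_sq (x : ℂ)
  have h3 := Complex.I_sq
  generalize Complex.cosh (γ : ℂ) = C at *
  generalize Complex.sinh (γ : ℂ) = S at *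
  generalize Complex.cos (x : ℂ) = c at *
  generalize Complex.sin (x : ℂ) = s at *
  have hleft : (C * c - 1) / (S * (C - c)) + Complex.I * (s / (C - c)) =
      (S + Complex.I * s) / (C - c) - C / S := by
    field_simp
    linear_combination h1
  rw [hleft, sub_left_inj, div_eq_div_iff hD hne]
  linear_combination h2 - h1 - s ^ 2 * h3

lemma integral_eq_zero_of_differentiable_closedBall {F : ℂ → ℂ}
    (hF : ∀ z ∈ Metric.closedBall (0 : ℂ) 1, DifferentiableAt ℂ F z) :
    ∫ x in (-Real.pi)..Real.pi, Complex.exp (Complex.I * x) * F (Complex.exp (Complex.I * x)) = 0 := by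
  have h := Complex.circleIntegral_eq_zero_of_differentiable_on_off_countable (c := 0)
    zero_le_one Set.countable_empty (fun z hz => (hF z hz).continuousAt.continuousWithinAt)
    (fun z hz => hF z (Metric.ball_subset_closedBall hz.1))
  have hper : Function.Periodic
      (fun x : ℝ => Complex.exp (Complex.I * x) * F (Complex.exp (Complex.I * x)))
      (2 * Real.pi) := by
    intro x
    have : Complex.exp (Complex.I * ((x + 2 * Real.pi : ℝ) : ℂ)) = Complex.exp (Complex.I * x) := by
      rw [← Complex.exp_periodic (Complex.I * x)]
      congr 1
      push_cast
      ring
    simp only [this]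
  have h2 := hper.intervalIntegral_add_eq (-Real.pi) 0
  rw [show -Real.pi + 2 * Real.pi = Real.pi by ring, zero_add] at h2
  rw [h2]
  simp only [circleIntegral, deriv_circleMap, circleMap, smul_eq_mul, zero_add,
    Complex.ofReal_one, one_mul, mul_comm _ Complex.I, mul_assoc,
    intervalIntegral.integral_const_mul] at h
  simpa using h

lemma integral_boWave_add_conjugatePoisson_mul_exp {γ : ℝ} (hγ : 0 < γ) (m : ℕ) :
    ∫ x in (-Real.pi)..Real.pi, ((boWave γ x : ℂ) + Complex.I * conjugatePoisson γ x) *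
      Complex.exp (Complex.I * (m + 1 : ℕ) * x) = 0 := by
  have h := integral_eq_zero_of_differentiable_closedBall
    (F := fun z => z ^ m * ((Complex.exp γ + z) / (Complex.exp γ - z)
      - Complex.cosh γ / Complex.sinh γ)) (by
    intro z hz
    have hne : Complex.exp γ - z ≠ 0 := by
      intro h
      rw [← sub_eq_zero.1 h] at hz
      simp [Complex.norm_exp] at hz
      linarith
    fun_prop (disch := exact hne))
  rw [← h]
  congr 1
  ext x
  rw [boWave_add_I_mul_conjugatePoisson hγ,
    show Complex.I * ((m + 1 : ℕ) : ℂ) * x = ((m + 1 : ℕ) : ℂ) * (Complex.I * x) by ring,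
    Complex.exp_nat_mul]
  ring

lemma boWave_stationary_neg_nat {γ : ℝ} (hγ : 0 < γ) (m : ℕ) :
    ((Real.cosh γ / Real.sinh γ - m : ℝ) : ℂ) * fourierCoeff2pi (boWave γ) (-m)
      + fourierCoeff2pi (fun x => (boWave γ x) ^ 2) (-m) = 0 := by
  have hφ := continuous_boWave hγ
  have hQ := continuous_conjugatePoisson hγ
  have hderiv : ∀ x : ℝ, HasDerivAt
      (fun x : ℝ => (conjugatePoisson γ x : ℂ) * Complex.exp (Complex.I * m * x))
      (((Real.cosh γ / Real.sinh γ * boWave γ x + boWave γ x ^ 2 : ℝ) : ℂ)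
          * Complex.exp (Complex.I * m * x)
        + conjugatePoisson γ x * (Complex.exp (Complex.I * m * x) * (Complex.I * m))) x := by
    intro x
    have hexp : HasDerivAt (fun x : ℝ => Complex.exp (Complex.I * m * x))
        (Complex.exp (Complex.I * m * x) * (Complex.I * m)) x := by
      simpa using ((Complex.ofRealCLM.hasDerivAt (x := x)).const_mul (Complex.I * m)).cexp
    exact (hasDerivAt_conjugatePoisson hγ x).ofReal_comp.mul hexp
  have hparts := intervalIntegral.integral_eq_sub_of_hasDerivAt (a := -Real.pi) (b := Real.pi)
    (fun x _ => hderiv x) (Continuous.intervalIntegrable (by fun_prop) _ _)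
  have hzero : (m : ℂ) * ∫ x in (-Real.pi)..Real.pi,
      ((boWave γ x : ℂ) + Complex.I * conjugatePoisson γ x) * Complex.exp (Complex.I * m * x)
        = 0 := by
    cases m with
    | zero => simp
    | succ k => rw [integral_boWave_add_conjugatePoisson_mul_exp hγ k, mul_zero]
  have hbdry : conjugatePoisson γ Real.pi = 0 ∧ conjugatePoisson γ (-Real.pi) = 0 := by
    simp [conjugatePoisson]
  rw [hbdry.1, hbdry.2, Complex.ofReal_zero, zero_mul, zero_mul, sub_zero] at hparts
  have hsum : ((Real.cosh γ / Real.sinh γ - m : ℝ) : ℂ) *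
        (∫ x in (-Real.pi)..Real.pi, (boWave γ x : ℂ) * Complex.exp (Complex.I * m * x))
      + ∫ x in (-Real.pi)..Real.pi,
          ((boWave γ x ^ 2 : ℝ) : ℂ) * Complex.exp (Complex.I * m * x) = 0 := by
    rw [← sub_zero (0 : ℂ)]
    nth_rewrite 1 [← hparts]
    rw [← hzero, ← intervalIntegral.integral_const_mul, ← intervalIntegral.integral_const_mul,
      ← intervalIntegral.integral_add, ← intervalIntegral.integral_sub]
    · congr 1
      ext x
      push_cast
      ring
    all_goals exact Continuous.intervalIntegrable (by fun_prop) _ _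
  unfold fourierCoeff2pi
  simp only [Int.cast_neg, Int.cast_natCast, mul_neg, neg_mul, neg_neg]
  linear_combination (1 / (2 * Real.pi) : ℂ) * hsum

theorem stmt11 (γ : ℝ) (hγ : 0 < γ) :
    Continuous (boWave γ) ∧ Function.Periodic (boWave γ) (2 * Real.pi) ∧
      (∀ n : ℤ,
        ((Real.cosh γ / Real.sinh γ - |(n : ℝ)| : ℝ) : ℂ) * fourierCoeff2pi (boWave γ) n
          + fourierCoeff2pi (fun x => (boWave γ x) ^ 2) n = 0) := by
  refine ⟨continuous_boWave hγ, periodic_boWave γ, fun n => ?_⟩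
  obtain ⟨m, rfl | rfl⟩ := n.eq_nat_or_neg
  · rw [← fourierCoeff2pi_neg_of_even (boWave_neg γ),
      ← fourierCoeff2pi_neg_of_even (f := fun x => boWave γ x ^ 2) (by simp [boWave_neg])]
    simpa using boWave_stationary_neg_nat hγ m
  · simpa using boWave_stationary_neg_nat hγ m
end

section
/- For every real α > log 3/log 2 − 1, the quantity Λ₂ := −1 + 3/(2^α − 1) − 7/(2^{α+1} − 3) is strictly negative. -/
theorem stmt15 (α : ℝ) (hα : Real.log 3 / Real.log 2 - 1 < α) :
    -1 + 3 / ((2 : ℝ) ^ α - 1) - 7 / ((2 : ℝ) ^ (α + 1) - 3) < 0 := by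
  have hlog : Real.log 3 < (α + 1) * Real.log 2 :=
    (div_lt_iff₀ (Real.log_pos one_lt_two)).1 (by linarith)
  have h3 : (3 : ℝ) < 2 ^ (α + 1) :=
    (Real.lt_rpow_iff_log_lt (by norm_num) (by norm_num)).2 hlog
  rw [Real.rpow_add_one two_ne_zero] at h3 ⊢
  generalize (2 : ℝ) ^ α = x at h3 ⊢
  have h₁ : 0 < x - 1 := by linarith
  have h₂ : 0 < x * 2 - 3 := by linarith
  have key : -1 + 3 / (x - 1) - 7 / (x * 2 - 3) =
      -(2 * (x - 1) ^ 2 + 3) / ((x - 1) * (x * 2 - 3)) := by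
    field_simp
    ring
  rw [key]
  exact div_neg_of_neg_of_pos (neg_neg_of_pos (by positivity)) (mul_pos h₁ h₂)
end
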